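/- arXiv:2104.14941 — 8 statements merged into one kernel-verified Lean document; each statement's English description precedes it below -/
import Mathlib

section
/- Fix constants V ∈ ℝ, P > 0, γ > 1, L > 0. Let r, ρ, u, p : ℝ × ℝ → ℝ be continuously differentiable functions of (x,t), L-periodic in x, with r > 0, satisfying r_t + V r_x = 0 and the linearized Euler equations ρ_t + Vρ_x + (ru)_x = 0, u_t + Vu_x + p_x/r = 0, p_t + Vp_x + γP u_x = 0. Then the total reduced energy ∫_0^L 𝓔(x,t) dx, where 𝓔 = p²/(2γP) + (1/2) r u², is constant in time. -/
theorem ContDiff.hasDerivAt_partial_fst {f : ℝ → ℝ → ℝ}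
    (hf : ContDiff ℝ 1 fun q : ℝ × ℝ => f q.1 q.2) (x t : ℝ) :
    HasDerivAt (fun y => f y t) (fderiv ℝ (fun q : ℝ × ℝ => f q.1 q.2) (x, t) (1, 0)) x :=
  ((hf.differentiable one_ne_zero) (x, t)).hasFDerivAt.comp_hasDerivAt
    (f := fun y => (y, t)) x ((hasDerivAt_id x).prodMk (hasDerivAt_const x t))

theorem ContDiff.hasDerivAt_partial_snd {f : ℝ → ℝ → ℝ}
    (hf : ContDiff ℝ 1 fun q : ℝ × ℝ => f q.1 q.2) (x t : ℝ) :
    HasDerivAt (fun s => f x s) (fderiv ℝ (fun q : ℝ × ℝ => f q.1 q.2) (x, t) (0, 1)) t :=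
  ((hf.differentiable one_ne_zero) (x, t)).hasFDerivAt.comp_hasDerivAt
    (f := fun s => (x, s)) t ((hasDerivAt_const t x).prodMk (hasDerivAt_id t))

/-- If a density `e` and a flux `F` satisfy the conservation law `e_t + F_x = 0` and the flux agrees
at both ends of `[a, b]`, then the integral of `e` over `[a, b]` does not depend on time. -/
theorem intervalIntegral_eq_of_conservation_law {e F : ℝ → ℝ → ℝ} {a b : ℝ}
    (he : ContDiff ℝ 1 fun q : ℝ × ℝ => e q.1 q.2)
    (hF : ContDiff ℝ 1 fun q : ℝ × ℝ => F q.1 q.2)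
    (hends : ∀ t, F b t = F a t)
    (hcons : ∀ x t, deriv (fun s => e x s) t + deriv (fun y => F y t) x = 0) (t₁ t₂ : ℝ) :
    ∫ x in a..b, e x t₁ = ∫ x in a..b, e x t₂ := by
  have hdiv (q : ℝ × ℝ) : fderiv ℝ (fun q : ℝ × ℝ => F q.1 q.2) q (1, 0) +
      fderiv ℝ (fun q : ℝ × ℝ => e q.1 q.2) q (0, 1) = 0 := by
    have h := hcons q.1 q.2
    rw [(he.hasDerivAt_partial_snd q.1 q.2).deriv, (hF.hasDerivAt_partial_fst q.1 q.2).deriv] at h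
    rw [add_comm]
    exact h
  have h := MeasureTheory.integral2_divergence_prod_of_hasFDerivAt
    (fun q : ℝ × ℝ => F q.1 q.2) (fun q : ℝ × ℝ => e q.1 q.2) _ _ a t₁ b t₂
    hF.continuous.continuousOn he.continuous.continuousOn
    (fun q _ => ((hF.differentiable one_ne_zero) q).hasFDerivAt)
    (fun q _ => ((he.differentiable one_ne_zero) q).hasFDerivAt)
    (by simp only [hdiv]; exact MeasureTheory.integrableOn_zero)
  simp only [hdiv, hends, intervalIntegral.integral_zero] at h
  linarith

/-- for L-periodic solutions of the linearized Euler equations around a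
density wave, the total reduced energy ∫₀ᴸ 𝓔 dx is constant in time. -/
theorem total_reduced_energy_constant (V P γ L : ℝ) (hP : 0 < P) (hγ : 1 < γ) (hL : 0 < L)
    (r ρ u p : ℝ → ℝ → ℝ)
    (hr : ContDiff ℝ 1 fun q : ℝ × ℝ => r q.1 q.2)
    (hρ : ContDiff ℝ 1 fun q : ℝ × ℝ => ρ q.1 q.2)
    (hu : ContDiff ℝ 1 fun q : ℝ × ℝ => u q.1 q.2)
    (hp : ContDiff ℝ 1 fun q : ℝ × ℝ => p q.1 q.2)
    (hrper : ∀ x t, r (x + L) t = r x t)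
    (hρper : ∀ x t, ρ (x + L) t = ρ x t)
    (huper : ∀ x t, u (x + L) t = u x t)
    (hpper : ∀ x t, p (x + L) t = p x t)
    (hrpos : ∀ x t, 0 < r x t)
    (hbase : ∀ x t, deriv (fun s => r x s) t + V * deriv (fun y => r y t) x = 0)
    (hρeq : ∀ x t, deriv (fun s => ρ x s) t + V * deriv (fun y => ρ y t) x
        + deriv (fun y => r y t * u y t) x = 0)
    (hueq : ∀ x t, deriv (fun s => u x s) t + V * deriv (fun y => u y t) x
        + deriv (fun y => p y t) x / r x t = 0)
    (hpeq : ∀ x t, deriv (fun s => p x s) t + V * deriv (fun y => p y t) x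
        + γ * P * deriv (fun y => u y t) x = 0) :
    ∀ t₁ t₂ : ℝ,
      (∫ x in (0:ℝ)..L, ((p x t₁) ^ 2 / (2 * γ * P) + (1 / 2) * r x t₁ * (u x t₁) ^ 2))
        = ∫ x in (0:ℝ)..L, ((p x t₂) ^ 2 / (2 * γ * P) + (1 / 2) * r x t₂ * (u x t₂) ^ 2) := by
  refine intervalIntegral_eq_of_conservation_law
    (e := fun x t => (p x t) ^ 2 / (2 * γ * P) + (1 / 2) * r x t * (u x t) ^ 2)
    (F := fun x t => V * ((p x t) ^ 2 / (2 * γ * P) + (1 / 2) * r x t * (u x t) ^ 2)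
      + p x t * u x t)
    (by fun_prop) (by fun_prop) (fun t => ?_) (fun x t => ?_)
  · have hr0 := hrper 0 t
    have hu0 := huper 0 t
    have hp0 := hpper 0 t
    rw [zero_add] at hr0 hu0 hp0
    simp only [hr0, hu0, hp0]
  · have hrt := (hr.hasDerivAt_partial_snd x t).differentiableAt.hasDerivAt
    have hut := (hu.hasDerivAt_partial_snd x t).differentiableAt.hasDerivAt
    have hpt := (hp.hasDerivAt_partial_snd x t).differentiableAt.hasDerivAt
    have hrx := (hr.hasDerivAt_partial_fst x t).differentiableAt.hasDerivAt
    have hux := (hu.hasDerivAt_partial_fst x t).differentiableAt.hasDerivAt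
    have hpx := (hp.hasDerivAt_partial_fst x t).differentiableAt.hasDerivAt
    have het := ((hpt.fun_pow 2).div_const (2 * γ * P)).fun_add
      ((hrt.const_mul (1 / 2)).fun_mul (hut.fun_pow 2))
    have hFx := ((((hpx.fun_pow 2).div_const (2 * γ * P)).fun_add
      ((hrx.const_mul (1 / 2)).fun_mul (hux.fun_pow 2))).const_mul V).fun_add (hpx.fun_mul hux)
    rw [het.deriv, hFx.deriv, eq_neg_of_add_eq_zero_left (hbase x t),
      eq_neg_of_add_eq_zero_left ((add_assoc _ _ _).symm.trans (hueq x t)),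
      eq_neg_of_add_eq_zero_left ((add_assoc _ _ _).symm.trans (hpeq x t))]
    have hr0 : r x t ≠ 0 := (hrpos x t).ne'
    have hγ0 : γ ≠ 0 := by positivity
    field_simp
    ring
end

section
/- Let n ≥ 1 and let r, u : ℤ/nℤ → ℝ. With interface averages {φ}_{e+1/2} = (φ_e + φ_{e+1})/2 and differences Δψ_e = ψ_{e+1/2} − ψ_{e−1/2}, the following telescoping identity holds: Σ_{e ∈ ℤ/nℤ} [ u_e Δ({r}{u})_e − (1/2) u_e² Δ{r}_e ] = 0, where ({r}{u})_{e+1/2} = {r}_{e+1/2}·{u}_{e+1/2}. -/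
open Finset

/-- Backward differences sum to zero over a finite group. -/
theorem sum_sub_apply_sub_right_eq_zero {G M : Type*} [AddGroup G] [Fintype G] [AddCommGroup M]
    (g : G → M) (a : G) : ∑ e, (g e - g (e - a)) = 0 := by
  rw [Finset.sum_sub_distrib, sub_eq_zero]
  exact ((Equiv.subRight a).sum_comp g).symm

/-- periodic telescoping identity for the convective kinetic-energy terms of
the linearized mKEP scheme: Σ_e [ u_e Δ({r}{u})_e − (1/2) u_e² Δ{r}_e ] = 0. -/
theorem mkep_convective_telescoping (n : ℕ) [NeZero n] (hn : 1 ≤ n) (r u : ZMod n → ℝ) :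
    ∑ e : ZMod n,
      (u e * (((r e + r (e + 1)) / 2) * ((u e + u (e + 1)) / 2)
              - ((r (e - 1) + r e) / 2) * ((u (e - 1) + u e) / 2))
        - (1 / 2) * (u e) ^ 2 * ((r e + r (e + 1)) / 2 - (r (e - 1) + r e) / 2)) = 0 := by
  rw [← sum_sub_apply_sub_right_eq_zero
    (fun e : ZMod n => (r e + r (e + 1)) / 2 * (u e * u (e + 1) / 2)) 1]
  refine Finset.sum_congr rfl fun e _ => ?_
  simp only [sub_add_cancel]
  ring
end

section
/- Let n ≥ 1 and let r, u : ℤ/nℤ → ℝ. With interface averages {φ}_{e+1/2} = (φ_e + φ_{e+1})/2 and differences Δψ_e = ψ_{e+1/2} − ψ_{e−1/2}, the following identity holds: Σ_{e ∈ ℤ/nℤ} [ u_e Δ{r u}_e − (1/2) u_e² Δ{r}_e ] = (1/4) Σ_{e ∈ ℤ/nℤ} (r_e − r_{e+1})(u_e − u_{e+1})², where {r u}_{e+1/2} = (r_e u_e + r_{e+1} u_{e+1})/2. In particular this sum does not vanish in general, so the linearized central scheme does not conserve the reduced perturbation energy. -/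
open Finset

/-- Over a finite additive group, the differences of a function with its translate sum to zero. -/
lemma sum_add_right_sub_self {G M : Type*} [AddGroup G] [Fintype G] [AddCommGroup M]
    (f : G → M) (a : G) : ∑ x, (f (x + a) - f x) = 0 := by
  rw [Finset.sum_sub_distrib, sub_eq_zero]
  exact Equiv.sum_comp (Equiv.addRight a) f

/-- for the linearized central scheme,
Σ_e [ u_e Δ{ru}_e − (1/2) u_e² Δ{r}_e ] = (1/4) Σ_e (r_e − r_{e+1})(u_e − u_{e+1})². -/
theorem central_scheme_energy_defect (n : ℕ) [NeZero n] (hn : 1 ≤ n) (r u : ZMod n → ℝ) :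
    ∑ e : ZMod n,
      (u e * ((r e * u e + r (e + 1) * u (e + 1)) / 2
              - (r (e - 1) * u (e - 1) + r e * u e) / 2)
        - (1 / 2) * (u e) ^ 2 * ((r e + r (e + 1)) / 2 - (r (e - 1) + r e) / 2))
      = (1 / 4) * ∑ e : ZMod n, (r e - r (e + 1)) * (u e - u (e + 1)) ^ 2 := by
  rw [← sub_eq_zero, Finset.mul_sum, ← Finset.sum_sub_distrib,
    ← sum_add_right_sub_self (fun e : ZMod n =>
      r e * u e ^ 2 / 4 + r (e - 1) * u (e - 1) * u e / 2 - u e ^ 2 * r (e - 1) / 4) 1]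
  refine Finset.sum_congr rfl fun e _ => ?_
  simp only [add_sub_cancel_right]
  ring
end

section
/- Fix constants V ∈ ℝ, P > 0, γ > 1, Δx > 0, and n ≥ 1. Let r, ρ, u, p : ℝ → (ℤ/nℤ → ℝ) be differentiable functions of time satisfying, for every cell e ∈ ℤ/nℤ: Δx·(d/dt) r_e = −V Δ{r}_e; Δx·(d/dt)(r_e u_e) = −V Δ({r}{u})_e − Δ{p}_e; and Δx·(d/dt) p_e = −V Δ{p}_e − γP Δ{u}_e, where {φ}_{e+1/2} = (φ_e + φ_{e+1})/2 and Δψ_e = ψ_{e+1/2} − ψ_{e−1/2}. Then the total reduced perturbation energy Σ_{e ∈ ℤ/nℤ} [ p_e²/(2γP) + (1/2) r_e u_e² ] is constant in time; i.e., the linearized modified KEP finite difference scheme conserves the reduced energy. -/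
open Finset

/-- Differences of interface fluxes sum to zero over a periodic grid. -/
theorem ZMod.sum_sub_shift_eq_zero {n : ℕ} [NeZero n] (F : ZMod n → ℝ) :
    ∑ e : ZMod n, (F e - F (e - 1)) = 0 := by
  rw [Finset.sum_sub_distrib, sub_eq_zero]
  exact (Equiv.sum_comp (Equiv.subRight (1 : ZMod n)) F).symm

/-- The derivative of `p² / (2c) + ρu² / 2`, with the kinetic part expressed through the
derivatives of the mass `ρ` and the momentum `ρu`. -/
theorem hasDerivAt_reduced_energy {c t : ℝ} {ρ u p : ℝ → ℝ} (hρ : DifferentiableAt ℝ ρ t)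
    (hu : DifferentiableAt ℝ u t) (hp : DifferentiableAt ℝ p t) :
    HasDerivAt (fun s => p s ^ 2 / (2 * c) + 1 / 2 * ρ s * u s ^ 2)
      (p t * deriv p t / c + u t * deriv (fun s => ρ s * u s) t
        - u t ^ 2 / 2 * deriv ρ t) t := by
  have hm : deriv (fun s => ρ s * u s) t = deriv ρ t * u t + ρ t * deriv u t :=
    (hρ.hasDerivAt.mul hu.hasDerivAt).deriv
  rw [hm]
  refine (((hp.hasDerivAt.pow 2).div_const (2 * c)).add
    ((hρ.hasDerivAt.const_mul (1 / 2)).mul (hu.hasDerivAt.pow 2))).congr_deriv ?_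
  push_cast
  simp only [Pi.pow_apply]
  ring

/-- the linearized modified KEP (mKEP) finite difference scheme conserves
the total reduced perturbation energy Σ_e [ p_e²/(2γP) + (1/2) r_e u_e² ]. -/
theorem mkep_fd_reduced_energy_conserved (V P γ Δx : ℝ) (hP : 0 < P) (hγ : 1 < γ)
    (hΔx : 0 < Δx) (n : ℕ) [NeZero n] (hn : 1 ≤ n)
    (r ρ u p : ℝ → ZMod n → ℝ)
    (hr : ∀ e, Differentiable ℝ fun t => r t e)
    (hρ : ∀ e, Differentiable ℝ fun t => ρ t e)
    (hu : ∀ e, Differentiable ℝ fun t => u t e)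
    (hp : ∀ e, Differentiable ℝ fun t => p t e)
    (hreq : ∀ t e, Δx * deriv (fun s => r s e) t
      = -V * ((r t e + r t (e + 1)) / 2 - (r t (e - 1) + r t e) / 2))
    (hmeq : ∀ t e, Δx * deriv (fun s => r s e * u s e) t
      = -V * (((r t e + r t (e + 1)) / 2) * ((u t e + u t (e + 1)) / 2)
              - ((r t (e - 1) + r t e) / 2) * ((u t (e - 1) + u t e) / 2))
        - ((p t e + p t (e + 1)) / 2 - (p t (e - 1) + p t e) / 2))
    (hpeq : ∀ t e, Δx * deriv (fun s => p s e) t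
      = -V * ((p t e + p t (e + 1)) / 2 - (p t (e - 1) + p t e) / 2)
        - γ * P * ((u t e + u t (e + 1)) / 2 - (u t (e - 1) + u t e) / 2)) :
    ∀ t₁ t₂ : ℝ,
      ∑ e : ZMod n, ((p t₁ e) ^ 2 / (2 * γ * P) + (1 / 2) * r t₁ e * (u t₁ e) ^ 2)
        = ∑ e : ZMod n, ((p t₂ e) ^ 2 / (2 * γ * P) + (1 / 2) * r t₂ e * (u t₂ e) ^ 2) := by
  have hderiv (t : ℝ) : HasDerivAt (fun s =>
      ∑ e : ZMod n, ((p s e) ^ 2 / (2 * γ * P) + (1 / 2) * r s e * (u s e) ^ 2)) 0 t := by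
    have hsum := HasDerivAt.fun_sum (u := Finset.univ) fun (e : ZMod n) _ =>
      hasDerivAt_reduced_energy (c := γ * P) (hr e t) (hu e t) (hp e t)
    simp only [← mul_assoc] at hsum
    refine hsum.congr_deriv ?_
    let F : ZMod n → ℝ := fun e =>
      -V / (2 * (γ * P)) * (p t e * p t (e + 1))
        - V / 4 * ((r t e + r t (e + 1)) * (u t e * u t (e + 1)))
        - (p t e * u t (e + 1) + u t e * p t (e + 1)) / 2
    apply (mul_eq_zero_iff_left hΔx.ne').mp
    rw [Finset.mul_sum, ← ZMod.sum_sub_shift_eq_zero F]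
    refine Finset.sum_congr rfl fun e _ => ?_
    have hγ0 : γ ≠ 0 := by positivity
    simp only [F, sub_add_cancel]
    calc
      _ = p t e * (Δx * deriv (fun s => p s e) t) / (γ * P)
          + u t e * (Δx * deriv (fun s => r s e * u s e) t)
          - u t e ^ 2 / 2 * (Δx * deriv (fun s => r s e) t) := by ring
      _ = _ := by
        rw [hreq, hmeq, hpeq]
        field_simp
        ring
  exact is_const_of_deriv_eq_zero (fun t => (hderiv t).differentiableAt) fun t => (hderiv t).deriv
end

section
/- Fix constants V ∈ ℝ, P > 0, γ > 1, Δx > 0, and n ≥ 1. Let r, u, p : ℝ → (ℤ/nℤ → ℝ) be differentiable functions of time satisfying, for every cell e ∈ ℤ/nℤ: Δx·(d/dt) r_e = −V Δ{r}_e; Δx·(d/dt)(r_e u_e) = −V Δ{r u}_e − Δ{p}_e; and Δx·(d/dt) p_e = −V Δ{p}_e − γP Δ{u}_e, where {φ}_{e+1/2} = (φ_e + φ_{e+1})/2, {r u}_{e+1/2} = (r_e u_e + r_{e+1} u_{e+1})/2, and Δψ_e = ψ_{e+1/2} − ψ_{e−1/2}. Then the total reduced energy satisfies Δx·(d/dt)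 Σ_{e ∈ ℤ/nℤ} [ p_e²/(2γP) + (1/2) r_e u_e² ] = (V/4) Σ_{e ∈ ℤ/nℤ} (r_{e+1} − r_e)(u_{e+1} − u_e)², a volumetric term of indeterminate sign; hence the linearized central scheme does not conserve the reduced energy. -/
open Finset

/-- for the linearized central finite difference scheme, the total reduced
energy satisfies Δx·d/dt Σ_e 𝓔_e = (V/4) Σ_e (r_{e+1} − r_e)(u_{e+1} − u_e)², a volumetric
term of indeterminate sign, hence reduced energy is not conserved. -/
theorem central_fd_reduced_energy_rate (V P γ Δx : ℝ) (hP : 0 < P) (hγ : 1 < γ)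
    (hΔx : 0 < Δx) (n : ℕ) [NeZero n] (hn : 1 ≤ n)
    (r ρ u p : ℝ → ZMod n → ℝ)
    (hr : ∀ e, Differentiable ℝ fun t => r t e)
    (hρ : ∀ e, Differentiable ℝ fun t => ρ t e)
    (hu : ∀ e, Differentiable ℝ fun t => u t e)
    (hp : ∀ e, Differentiable ℝ fun t => p t e)
    (hreq : ∀ t e, Δx * deriv (fun s => r s e) t
      = -V * ((r t e + r t (e + 1)) / 2 - (r t (e - 1) + r t e) / 2))
    (hmeq : ∀ t e, Δx * deriv (fun s => r s e * u s e) t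
      = -V * ((r t e * u t e + r t (e + 1) * u t (e + 1)) / 2
              - (r t (e - 1) * u t (e - 1) + r t e * u t e) / 2)
        - ((p t e + p t (e + 1)) / 2 - (p t (e - 1) + p t e) / 2))
    (hpeq : ∀ t e, Δx * deriv (fun s => p s e) t
      = -V * ((p t e + p t (e + 1)) / 2 - (p t (e - 1) + p t e) / 2)
        - γ * P * ((u t e + u t (e + 1)) / 2 - (u t (e - 1) + u t e) / 2)) :
    ∀ t : ℝ,
      Δx * deriv (fun s =>
          ∑ e : ZMod n, ((p s e) ^ 2 / (2 * γ * P) + (1 / 2) * r s e * (u s e) ^ 2)) t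
        = (V / 4) * ∑ e : ZMod n, (r t (e + 1) - r t e) * (u t (e + 1) - u t e) ^ 2 := by
  intro t
  have hP0 : P ≠ 0 := hP.ne'
  have hγ0 : γ ≠ 0 := by positivity
  -- The derivative of `r u² / 2` is expressed through those of `r u` and `r`.
  have henergy : ∀ e, HasDerivAt
      (fun s => (p s e) ^ 2 / (2 * γ * P) + (1 / 2) * r s e * (u s e) ^ 2)
      (p t e * deriv (fun s => p s e) t / (γ * P)
        + u t e * deriv (fun s => r s e * u s e) t
        - (1 / 2) * (u t e) ^ 2 * deriv (fun s => r s e) t) t := by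
    intro e
    have hrt := (hr e t).hasDerivAt
    have hut := (hu e t).hasDerivAt
    have hpt := (hp e t).hasDerivAt
    rw [(hrt.fun_mul hut).deriv]
    refine (((hpt.fun_pow 2).div_const (2 * γ * P)).fun_add
      ((hrt.const_mul (1 / 2)).fun_mul (hut.fun_pow 2))).congr_deriv ?_
    field_simp
    ring
  -- The part of the local energy balance that telescopes over the periodic grid.
  let K : ZMod n → ℝ := fun e =>
    V / 2 * (u t (e + 1) * r t e * u t e) + u t (e + 1) * p t e / 2
      - V / 4 * (r t e * u t (e + 1) ^ 2) + V / (2 * γ * P) * (p t e * p t (e + 1))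
      + u t e * p t (e + 1) / 2 + V / 4 * (r t (e + 1) * u t (e + 1) ^ 2)
  have hlocal : ∀ e,
      Δx * (p t e * deriv (fun s => p s e) t / (γ * P)
        + u t e * deriv (fun s => r s e * u s e) t
        - (1 / 2) * (u t e) ^ 2 * deriv (fun s => r s e) t)
      = V / 4 * ((r t (e + 1) - r t e) * (u t (e + 1) - u t e) ^ 2) + (K (e - 1) - K e) := by
    intro e
    calc
      _ = p t e * (Δx * deriv (fun s => p s e) t) / (γ * P)
          + u t e * (Δx * deriv (fun s => r s e * u s e) t)
          - (1 / 2) * (u t e) ^ 2 * (Δx * deriv (fun s => r s e) t) := by ring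
      _ = _ := by
        rw [hpeq, hmeq, hreq]
        simp only [K, sub_add_cancel]
        field_simp
        ring
  have hshift : ∑ e, K (e - 1) = ∑ e, K e := (Equiv.subRight (1 : ZMod n)).sum_comp K
  rw [(HasDerivAt.fun_sum fun e _ => henergy e).deriv, mul_sum, sum_congr rfl fun e _ => hlocal e,
    sum_add_distrib, sum_sub_distrib, hshift, sub_self, add_zero, mul_sum]
end

section
/- Fix constants V ∈ ℝ, Δx > 0, and n ≥ 1. Let r, ρ, u : ℝ → (ℤ/nℤ → ℝ) be differentiable functions of time with the linearized mKEP density equation holding for every cell e ∈ ℤ/nℤ: Δx·(d/dt) ρ_e = −V Δ{ρ}_e − Δ({r}{u})_e, where {φ}_{e+1/2} = (φ_e + φ_{e+1})/2 and Δψ_e = ψ_{e+1/2} − ψ_{e−1/2}. Then Δx·(d/dt) Σ_{e ∈ ℤ/nℤ} (1/2) ρ_e² = −Σ_{e ∈ ℤ/nℤ} ρ_e Δ({r}{u})_e; in particular the convective terms involving V cancel exactly and do not contribute to the accumulation of density perturbations. -/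
open Finset

/-- Summation by parts on a finite ring: a central difference is orthogonal to the function. -/
theorem sum_mul_central_difference_eq_zero {R : Type*} [Ring R] [Fintype R] (f : R → ℝ) :
    ∑ e, f e * ((f e + f (e + 1)) / 2 - (f (e - 1) + f e) / 2) = 0 := by
  have h : ∑ e, f (e - 1) * f e = ∑ e, f e * f (e + 1) := by
    simpa using (Equiv.sum_comp (Equiv.addRight (1 : R)) fun e => f (e - 1) * f e).symm
  calc ∑ e, f e * ((f e + f (e + 1)) / 2 - (f (e - 1) + f e) / 2)
      = ((∑ e, f e * f (e + 1)) - ∑ e, f (e - 1) * f e) / 2 := by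
        rw [← Finset.sum_sub_distrib, Finset.sum_div]
        exact Finset.sum_congr rfl fun e _ => by ring
    _ = 0 := by rw [h, sub_self, zero_div]

/-- for the linearized mKEP density equation, the total density
perturbation energy satisfies Δx·d/dt Σ_e ρ_e²/2 = −Σ_e ρ_e Δ({r}{u})_e; the convective
terms involving V cancel exactly. -/
theorem mkep_density_perturbation_energy (V Δx : ℝ) (hΔx : 0 < Δx)
    (n : ℕ) [NeZero n] (hn : 1 ≤ n)
    (r ρ u : ℝ → ZMod n → ℝ)
    (hr : ∀ e, Differentiable ℝ fun t => r t e)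
    (hρ : ∀ e, Differentiable ℝ fun t => ρ t e)
    (hu : ∀ e, Differentiable ℝ fun t => u t e)
    (hρeq : ∀ t e, Δx * deriv (fun s => ρ s e) t
      = -V * ((ρ t e + ρ t (e + 1)) / 2 - (ρ t (e - 1) + ρ t e) / 2)
        - (((r t e + r t (e + 1)) / 2) * ((u t e + u t (e + 1)) / 2)
            - ((r t (e - 1) + r t e) / 2) * ((u t (e - 1) + u t e) / 2))) :
    ∀ t : ℝ,
      Δx * deriv (fun s => ∑ e : ZMod n, (1 / 2) * (ρ s e) ^ 2) t
        = -∑ e : ZMod n, ρ t e *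
            (((r t e + r t (e + 1)) / 2) * ((u t e + u t (e + 1)) / 2)
              - ((r t (e - 1) + r t e) / 2) * ((u t (e - 1) + u t e) / 2)) := by
  intro t
  have hderiv : HasDerivAt (fun s => ∑ e : ZMod n, (1 / 2) * (ρ s e) ^ 2)
      (∑ e : ZMod n, ρ t e * deriv (fun s => ρ s e) t) t := by
    refine HasDerivAt.fun_sum fun e _ => ?_
    refine (((hρ e t).hasDerivAt.fun_pow 2).const_mul (1 / 2 : ℝ)).congr_deriv ?_
    push_cast
    ring
  have hterm : ∀ e, Δx * (ρ t e * deriv (fun s => ρ s e) t)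
      = -V * (ρ t e * ((ρ t e + ρ t (e + 1)) / 2 - (ρ t (e - 1) + ρ t e) / 2))
        - ρ t e * (((r t e + r t (e + 1)) / 2) * ((u t e + u t (e + 1)) / 2)
            - ((r t (e - 1) + r t e) / 2) * ((u t (e - 1) + u t e) / 2)) := fun e => by
    rw [mul_left_comm, hρeq]
    ring
  rw [hderiv.deriv, Finset.mul_sum, Finset.sum_congr rfl fun e _ => hterm e,
    Finset.sum_sub_distrib, ← Finset.mul_sum, sum_mul_central_difference_eq_zero (ρ t),
    mul_zero, zero_sub]
end

section
/- Fix constants P > 0, γ > 1, Δx > 0, and n ≥ 1, and set the advection speed V = 0. Let r : ℤ/nℤ → ℝ be strictly positive (time-independent base density) and let u, p : ℝ → (ℤ/nℤ → ℝ) be differentiable functions of time satisfying the linearized Kennedy–Gruber scheme for every cell e: Δx · r_e (d/dt) u_e = −Δ{p}_e and Δx·(d/dt) p_e = −(γ−1) P Δ(α{u})_e, where α_{e+1/2} = 1 + {r}_{e+1/2}{1/r}_{e+1/2}/(γ−1), {φ}_{e+1/2} = (φ_e + φ_{e+1})/2, and Δψ_e = ψ_{e+1/2} − ψ_{e−1/2}.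 Then, with β_{e+1/2} = {r}_{e+1/2}{1/r}_{e+1/2} − 1 ≥ 0, the total reduced energy satisfies Δx·(d/dt) Σ_{e ∈ ℤ/nℤ} [ p_e²/(2γP) + (1/2) r_e u_e² ] = (1/γ) Σ_{e ∈ ℤ/nℤ} β_{e+1/2} {u}_{e+1/2} (p_{e+1} − p_e), a term of indeterminate sign; hence even without advection the Kennedy–Gruber flux is not consistent with reduced-energy conservation. -/
open Finset

theorem sum_sub_shift_eq_zero {G : Type*} [AddGroup G] [Fintype G] (F : G → ℝ) (a : G) :
    ∑ e, (F e - F (e - a)) = 0 := by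
  rw [Finset.sum_sub_distrib, sub_eq_zero]
  exact ((Equiv.subRight a).sum_comp F).symm

theorem one_le_mean_mul_mean_inv {a b : ℝ} (ha : 0 < a) (hb : 0 < b) :
    1 ≤ ((a + b) / 2) * ((1 / a + 1 / b) / 2) := by
  have h : ((a + b) / 2) * ((1 / a + 1 / b) / 2) - 1 = (a - b) ^ 2 / (4 * (a * b)) := by
    field_simp
    ring
  have : 0 ≤ (a - b) ^ 2 / (4 * (a * b)) := by positivity
  linarith

/-- for the linearized Kennedy–Gruber scheme without advection (V = 0),
with β_{e+1/2} = {r}{1/r} − 1 ≥ 0, the total reduced energy satisfies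
Δx·d/dt Σ_e 𝓔_e = (1/γ) Σ_e β_{e+1/2} {u}_{e+1/2} (p_{e+1} − p_e), of indeterminate sign. -/
theorem kg_fd_no_advection_energy_rate (P γ Δx : ℝ) (hP : 0 < P) (hγ : 1 < γ)
    (hΔx : 0 < Δx) (n : ℕ) [NeZero n] (hn : 1 ≤ n)
    (r : ZMod n → ℝ) (hrpos : ∀ e, 0 < r e)
    (u p : ℝ → ZMod n → ℝ)
    (hu : ∀ e, Differentiable ℝ fun t => u t e)
    (hp : ∀ e, Differentiable ℝ fun t => p t e)
    (hueq : ∀ t e, Δx * r e * deriv (fun s => u s e) t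
      = -((p t e + p t (e + 1)) / 2 - (p t (e - 1) + p t e) / 2))
    (hpeq : ∀ t e, Δx * deriv (fun s => p s e) t
      = -(γ - 1) * P *
          ((1 + ((r e + r (e + 1)) / 2) * ((1 / r e + 1 / r (e + 1)) / 2) / (γ - 1))
              * ((u t e + u t (e + 1)) / 2)
            - (1 + ((r (e - 1) + r e) / 2) * ((1 / r (e - 1) + 1 / r e) / 2) / (γ - 1))
              * ((u t (e - 1) + u t e) / 2))) :
    (∀ e : ZMod n, 0 ≤ ((r e + r (e + 1)) / 2) * ((1 / r e + 1 / r (e + 1)) / 2) - 1)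
    ∧ (∀ t : ℝ,
        Δx * deriv (fun s =>
            ∑ e : ZMod n, ((p s e) ^ 2 / (2 * γ * P) + (1 / 2) * r e * (u s e) ^ 2)) t
          = (1 / γ) * ∑ e : ZMod n,
              (((r e + r (e + 1)) / 2) * ((1 / r e + 1 / r (e + 1)) / 2) - 1)
                * ((u t e + u t (e + 1)) / 2) * (p t (e + 1) - p t e)) := by
  refine ⟨fun e => sub_nonneg.2 (one_le_mean_mul_mean_inv (hrpos e) (hrpos (e + 1))),
    fun t => ?_⟩
  have hderiv : HasDerivAt (fun s =>
      ∑ e : ZMod n, ((p s e) ^ 2 / (2 * γ * P) + (1 / 2) * r e * (u s e) ^ 2))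
      (∑ e : ZMod n, (2 * p t e * deriv (fun s => p s e) t / (2 * γ * P)
        + (1 / 2) * r e * (2 * u t e * deriv (fun s => u s e) t))) t := by
    refine HasDerivAt.fun_sum fun e _ => ?_
    have hpe := (((hp e) t).hasDerivAt.fun_pow 2).div_const (2 * γ * P)
    have hue := (((hu e) t).hasDerivAt.fun_pow 2).const_mul ((1 / 2) * r e)
    simpa using hpe.fun_add hue
  set b : ZMod n → ℝ := fun e =>
    ((r e + r (e + 1)) / 2) * ((1 / r e + 1 / r (e + 1)) / 2) with hb
  let F : ZMod n → ℝ := fun e =>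
    -((γ - 1) / γ) * ((1 + b e / (γ - 1)) * ((u t e + u t (e + 1)) / 2)) * p t (e + 1)
      + (u t (e + 1) * p t (e + 1) - u t (e + 1) * p t e) / 2
  rw [hderiv.deriv, Finset.mul_sum, Finset.mul_sum, ← sub_eq_zero, ← Finset.sum_sub_distrib,
    ← sum_sub_shift_eq_zero F 1]
  refine Finset.sum_congr rfl fun e _ => ?_
  have hγ0 : γ ≠ 0 := by linarith
  have hγ1 : γ - 1 ≠ 0 := by linarith
  have hP0 : P ≠ 0 := hP.ne'
  have hbe : ((r (e - 1) + r e) / 2) * ((1 / r (e - 1) + 1 / r e) / 2) = b (e - 1) := by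
    simp [hb]
  have hbe' : ((r e + r (e + 1)) / 2) * ((1 / r e + 1 / r (e + 1)) / 2) = b e := rfl
  have hpt := hpeq t e
  have hut := hueq t e
  rw [hbe, hbe'] at hpt
  have hsplit : Δx * (2 * p t e * deriv (fun s => p s e) t / (2 * γ * P)
        + (1 / 2) * r e * (2 * u t e * deriv (fun s => u s e) t))
      = p t e / (γ * P) * (Δx * deriv (fun s => p s e) t)
        + u t e * (Δx * r e * deriv (fun s => u s e) t) := by
    field_simp
  rw [hsplit, hpt, hut]
  simp only [F, sub_add_cancel]
  field_simp
  ring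
end

section
/- Fix constants V ≠ 0, P > 0, γ > 1. The 1-D Kennedy–Gruber (KG) energy flux F_E = {p}{u} + {ρ}{e}{u} with e = E/ρ = p/((γ−1)ρ) + u²/2 and {φ} = (φ_l + φ_r)/2, evaluated at two states with densities a, b > 0, common velocity V and common pressure P, satisfies the constancy condition F_E = γPV/(γ−1) + (1/2)V²·{a,b}·V (where {a,b} = (a+b)/2 equals F_ρ/V) if and only if a = b. Hence the KG flux does not in general maintain constancy of pressure for the density wave problem. -/
/-- Arithmetic average of two real values. -/
noncomputable def avg (a b : ℝ) : ℝ := (a + b) / 2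

/-- Kennedy–Gruber energy flux F_E = {p}{u} + {ρ}{e}{u} in primitive variables (ρ, u, p),
with specific total energy e = p/((γ−1)ρ) + u²/2. -/
noncomputable def kgFluxEne (γ : ℝ) (Ql Qr : ℝ × ℝ × ℝ) : ℝ :=
  avg Ql.2.2 Qr.2.2 * avg Ql.2.1 Qr.2.1
    + avg Ql.1 Qr.1 * avg (Ql.2.2 / ((γ - 1) * Ql.1) + Ql.2.1 ^ 2 / 2)
        (Qr.2.2 / ((γ - 1) * Qr.1) + Qr.2.1 ^ 2 / 2) * avg Ql.2.1 Qr.2.1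

/-- The defect of the Kennedy–Gruber energy flux in the constancy condition. -/
theorem kgFluxEne_sub_constancy (V P γ : ℝ) (hγ : γ - 1 ≠ 0) (a b : ℝ) (ha : a ≠ 0)
    (hb : b ≠ 0) :
    kgFluxEne γ (a, V, P) (b, V, P)
        - (γ * P * V / (γ - 1) + (1 / 2) * V ^ 2 * (((a + b) / 2) * V))
      = P * V * (a - b) ^ 2 / (4 * a * b * (γ - 1)) := by
  simp only [kgFluxEne, avg]
  field_simp
  ring

/-- for V ≠ 0, P > 0, γ > 1 and densities a, b > 0, the Kennedy–Gruber
energy flux satisfies the constancy condition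
F_E = γPV/(γ−1) + (1/2)V²·((a+b)/2)·V if and only if a = b; hence the KG flux does not
in general maintain constancy of pressure for the density wave problem. -/
theorem kg_energy_flux_constancy_iff (V P γ : ℝ) (hV : V ≠ 0) (hP : 0 < P) (hγ : 1 < γ)
    (a b : ℝ) (ha : 0 < a) (hb : 0 < b) :
    kgFluxEne γ (a, V, P) (b, V, P)
      = γ * P * V / (γ - 1) + (1 / 2) * V ^ 2 * (((a + b) / 2) * V) ↔ a = b := by
  have h : γ - 1 ≠ 0 := (sub_pos.mpr hγ).ne'
  rw [← sub_eq_zero, kgFluxEne_sub_constancy V P γ h a b ha.ne' hb.ne']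
  simp [hV, hP.ne', ha.ne', hb.ne', h, sub_eq_zero]
end
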